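/- There exist absolute constants τ > 0, c ≥ τ, c' > 0 and n₀ ∈ ℕ such that for all n ≥ n₀ the following holds. Let K ⊆ ℝⁿ be a convex set (viewed as a ±1-valued function) with |vol(K) − 1/2| ≤ c/n and with B(0ⁿ, τ) ⊆ K. Then the Hermite weight of K at levels 0, 1 and 2 satisfies W^{≤2}[K] ≥ c'/n². -/

import Mathlib

open MeasureTheory ProbabilityTheory

/-- The standard Gaussian measure `N(0,1)ⁿ` on `ℝⁿ`. -/
noncomputable def stdGaussian (n : ℕ) : Measure (EuclideanSpace ℝ (Fin n)) :=
  (Measure.pi fun _ : Fin n => gaussianReal 0 1).map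
    (EuclideanSpace.equiv (Fin n) ℝ).symm

open Classical in
/-- The `±1`-valued function associated to a set `K`. -/
noncomputable def pmInd {n : ℕ} (K : Set (EuclideanSpace ℝ (Fin n)))
    (x : EuclideanSpace ℝ (Fin n)) : ℝ :=
  if x ∈ K then 1 else -1

/-- The normalized probabilists' Hermite polynomial `h_d(x) = He_d(x)/√(d!)`,
orthonormal with respect to `N(0,1)`. -/
noncomputable def normHermite (d : ℕ) (x : ℝ) : ℝ :=
  (Polynomial.aeval x (Polynomial.hermite d)) / Real.sqrt (Nat.factorial d)

/-- The Hermite coefficient `f̃(S) = E_{g ∼ N(0,1)ⁿ}[f(g) · ∏ᵢ h_{Sᵢ}(gᵢ)]`. -/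
noncomputable def hermiteCoeff (n : ℕ) (f : EuclideanSpace ℝ (Fin n) → ℝ)
    (S : Fin n → ℕ) : ℝ :=
  ∫ x, f x * ∏ i, normHermite (S i) (x i) ∂(stdGaussian n)

/-- The Hermite weight of `f` at level `j`: `W^{=j}[f] = Σ_{|S| = j} f̃(S)²`. -/
noncomputable def hermiteWeight (n : ℕ) (f : EuclideanSpace ℝ (Fin n) → ℝ)
    (j : ℕ) : ℝ :=
  ∑' S : {S : Fin n → ℕ // ∑ i, S i = j}, (hermiteCoeff n f S.1) ^ 2

/-- The Gaussian volume of `K ⊆ ℝⁿ`. -/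
noncomputable def gaussVol (n : ℕ) (K : Set (EuclideanSpace ℝ (Fin n))) : ℝ :=
  (stdGaussian n K).toReal

section GaussianMeasure

variable {E : Type*} [NormedAddCommGroup E] [InnerProductSpace ℝ E]

/-- The density of the standard Gaussian measure with respect to Lebesgue measure. -/
noncomputable def gaussDensity (x : E) : ℝ :=
  ((2 * Real.pi) ^ (Module.finrank ℝ E / 2 : ℝ))⁻¹ * Real.exp (-(1 / 2) * ‖x‖ ^ 2)

lemma gaussDensity_pos (x : E) : 0 < gaussDensity x := by
  unfold gaussDensity; positivity

lemma continuous_gaussDensity : Continuous (gaussDensity : E → ℝ) := by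
  unfold gaussDensity; fun_prop

variable [FiniteDimensional ℝ E] [MeasurableSpace E] [BorelSpace E]

lemma integrable_gaussDensity : Integrable (gaussDensity : E → ℝ) := by
  refine Integrable.const_mul ?_ _
  have h := (GaussianFourier.integrable_cexp_neg_mul_sq_norm_add (V := E)
    (b := ((1 / 2 : ℝ) : ℂ)) (by norm_num) 0 0).norm
  refine h.congr (Filter.Eventually.of_forall fun x => ?_)
  simp only [Complex.norm_exp]
  congr 1
  simp only [zero_mul, add_zero]
  norm_cast

lemma stdGaussian_eq_withDensity :
    ProbabilityTheory.stdGaussian E =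
      volume.withDensity (fun x : E => ENNReal.ofReal (gaussDensity x)) := by
  have : IsFiniteMeasure (volume.withDensity (fun x : E => ENNReal.ofReal (gaussDensity x))) :=
    isFiniteMeasure_withDensity_ofReal integrable_gaussDensity.2
  apply Measure.ext_of_charFun
  ext t
  rw [charFun_stdGaussian, charFun_apply, integral_withDensity_eq_integral_toReal_smul
    (continuous_gaussDensity.measurable.ennreal_ofReal) (by simp)]
  have h := GaussianFourier.integral_cexp_neg_mul_sq_norm_add (V := E)
    (b := ((1 / 2 : ℝ) : ℂ)) (by norm_num) Complex.I t
  have hC : ((Real.pi : ℂ) / ((1 / 2 : ℝ) : ℂ)) ^ (Module.finrank ℝ E / 2 : ℂ)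
      = (((2 * Real.pi) ^ (Module.finrank ℝ E / 2 : ℝ) : ℝ) : ℂ) := by
    rw [Complex.ofReal_cpow (by positivity)]
    push_cast
    congr 1
    ring
  rw [hC] at h
  have h0 : (((2 * Real.pi) ^ (Module.finrank ℝ E / 2 : ℝ) : ℝ) : ℂ) ≠ 0 := by
    have : (0 : ℝ) < (2 * Real.pi) ^ (Module.finrank ℝ E / 2 : ℝ) := by positivity
    exact_mod_cast this.ne'
  have h2 : ∀ x : E, (ENNReal.ofReal (gaussDensity x)).toReal •
      Complex.exp (inner ℝ x t * Complex.I) =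
      (((2 * Real.pi) ^ (Module.finrank ℝ E / 2 : ℝ) : ℝ) : ℂ)⁻¹ *
      Complex.exp (-((1 / 2 : ℝ) : ℂ) * ‖x‖ ^ 2 + Complex.I * inner ℝ t x) := by
    intro x
    rw [ENNReal.toReal_ofReal (gaussDensity_pos x).le, gaussDensity, Complex.real_smul,
      Complex.exp_add, real_inner_comm]
    push_cast
    rw [mul_assoc, mul_comm Complex.I]
  simp_rw [h2]
  rw [integral_const_mul, h, inv_mul_cancel_left₀ h0]
  congr 1
  rw [Complex.I_sq]
  push_cast
  ring

lemma integral_stdGaussian (f : E → ℝ) :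
    ∫ x, f x ∂(ProbabilityTheory.stdGaussian E) = ∫ x, gaussDensity x * f x := by
  rw [stdGaussian_eq_withDensity, integral_withDensity_eq_integral_toReal_smul
    (continuous_gaussDensity.measurable.ennreal_ofReal) (by simp)]
  simp_rw [ENNReal.toReal_ofReal (gaussDensity_pos _).le, smul_eq_mul]

lemma integrable_gaussDensity_mul {f : E → ℝ}
    (hf : Integrable f (ProbabilityTheory.stdGaussian E)) :
    Integrable (fun x => gaussDensity x * f x) := by
  rw [stdGaussian_eq_withDensity, integrable_withDensity_iff_integrable_smul'
    (continuous_gaussDensity.measurable.ennreal_ofReal) (by simp)] at hf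
  simpa only [ENNReal.toReal_ofReal (gaussDensity_pos _).le, smul_eq_mul] using hf

lemma map_rotation_stdGaussian (θ : ℝ) :
    ((ProbabilityTheory.stdGaussian E).prod (ProbabilityTheory.stdGaussian E)).map
      (fun p => Real.cos θ • p.1 + Real.sin θ • p.2) = ProbabilityTheory.stdGaussian E := by
  set γ := ProbabilityTheory.stdGaussian E
  have : (γ.prod γ).map (fun p => Real.cos θ • p.1 + Real.sin θ • p.2) =
      Measure.conv (γ.map (Real.cos θ • ·)) (γ.map (Real.sin θ • ·)) := by
    rw [Measure.conv, Measure.map_prod_map _ _ (by fun_prop) (by fun_prop),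
      Measure.map_map (by fun_prop) (by fun_prop)]
    rfl
  rw [this]
  have := Measure.isProbabilityMeasure_map (μ := γ) (f := (Real.cos θ • ·))
    (by fun_prop)
  have := Measure.isProbabilityMeasure_map (μ := γ) (f := (Real.sin θ • ·))
    (by fun_prop)
  apply Measure.ext_of_charFun
  ext t
  rw [charFun_conv, charFun_map_smul, charFun_map_smul, charFun_stdGaussian, charFun_stdGaussian,
    charFun_stdGaussian, ← Complex.exp_add, norm_smul, norm_smul]
  congr 1
  simp only [Real.norm_eq_abs, Complex.ofReal_mul, mul_pow]
  have h := Real.cos_sq_add_sin_sq θ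
  rw [← sq_abs (Real.cos θ), ← sq_abs (Real.sin θ)] at h
  have h' : ((|Real.cos θ| : ℝ) : ℂ) ^ 2 + ((|Real.sin θ| : ℝ) : ℂ) ^ 2 = 1 := by exact_mod_cast h
  linear_combination (-(‖t‖ : ℂ) ^ 2 / 2) * h'

lemma integrable_norm_sq_stdGaussian :
    Integrable (fun x : E => ‖x‖ ^ 2) (ProbabilityTheory.stdGaussian E) :=
  (IsGaussian.memLp_two_id (μ := ProbabilityTheory.stdGaussian E)).integrable_norm_pow (by norm_num)

lemma integral_norm_sq_stdGaussian :
    ∫ x : E, ‖x‖ ^ 2 ∂(ProbabilityTheory.stdGaussian E) = Module.finrank ℝ E := by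
  let b := stdOrthonormalBasis ℝ E
  have h1 : ∀ x : E, ‖x‖ ^ 2 = ∑ i, (innerSL ℝ (b i) x) ^ 2 := fun x => by
    simp only [innerSL_apply_apply]
    exact (b.sum_sq_inner_right x).symm
  have h2 : ∀ i, ∫ x : E, (innerSL ℝ (b i) x) ^ 2 ∂(ProbabilityTheory.stdGaussian E) = 1 := by
    intro i
    have h := variance_dual_stdGaussian (innerSL ℝ (b i))
    rw [variance_of_integral_eq_zero (by fun_prop)
      (integral_strongDual_stdGaussian _), innerSL_apply_norm] at h
    simpa using h
  simp_rw [h1]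
  rw [integral_finsetSum]
  · simp only [h2]
    simp
  · intro i _
    refine integrable_norm_sq_stdGaussian.mono' (by fun_prop) (Filter.Eventually.of_forall ?_)
    intro x
    rw [Real.norm_eq_abs, abs_of_nonneg (sq_nonneg _), h1 x]
    exact Finset.single_le_sum (f := fun i => (innerSL ℝ (b i) x) ^ 2)
      (fun _ _ => sq_nonneg _) (Finset.mem_univ i)

end GaussianMeasure

section ConvexShell

variable {E : Type*} [NormedAddCommGroup E] [InnerProductSpace ℝ E]

lemma exists_rotation_mem_shell {K : Set E} (hK : Convex ℝ K) (hball : Metric.ball 0 1 ⊆ K)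
    {t : ℝ} (ht0 : 0 < t) (ht1 : t < 1) {N : ℕ} (hN : 0 < N) {R : ℝ}
    (hR : Real.pi / N * R < 1 - t) {x y : E} (hx : t⁻¹ • x ∈ K) (hxR : ‖x‖ ≤ R)
    (hy : y ∉ K) (hyR : ‖y‖ ≤ R) :
    ∃ k ∈ Finset.range N, Real.cos ((k + 1) * (Real.pi / (2 * N))) • x +
      Real.sin ((k + 1) * (Real.pi / (2 * N))) • y ∈ K \ {x | t⁻¹ • x ∈ K} := by
  have h0K : (0 : E) ∈ K := hball (by simp)
  have hAK : ∀ z : E, t⁻¹ • z ∈ K → z ∈ K := fun z hz => by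
    have := hK.smul_mem_of_zero_mem h0K hz (t := t) ⟨ht0.le, ht1.le⟩
    rwa [smul_inv_smul₀ ht0.ne'] at this
  by_contra! hcon
  set δ : ℝ := Real.pi / (2 * N) with hδ
  have hN' : (0 : ℝ) < N := by exact_mod_cast hN
  have hδ0 : 0 < δ := by positivity
  let Z : ℕ → E := fun k => Real.cos (k * δ) • x + Real.sin (k * δ) • y
  have hstep : ∀ k, ‖Z (k + 1) - Z k‖ < 1 - t := by
    intro k
    have e : Z (k + 1) - Z k = (Real.cos ((k + 1 : ℕ) * δ) - Real.cos (k * δ)) • x +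
        (Real.sin ((k + 1 : ℕ) * δ) - Real.sin (k * δ)) • y := by
      simp only [Z, sub_smul]; abel
    have hd : |((k + 1 : ℕ) : ℝ) * δ - k * δ| = δ := by
      push_cast
      rw [add_mul, one_mul, add_sub_cancel_left, abs_of_pos hδ0]
    have hc := Real.abs_cos_sub_cos_le ((k + 1 : ℕ) * δ) (k * δ)
    have hs := Real.abs_sin_sub_sin_le ((k + 1 : ℕ) * δ) (k * δ)
    rw [hd] at hc hs
    calc ‖Z (k + 1) - Z k‖ ≤ δ * R + δ * R := by
          rw [e]
          refine (norm_add_le _ _).trans ?_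
          rw [norm_smul, norm_smul]
          simp only [Real.norm_eq_abs]
          gcongr
      _ = Real.pi / N * R := by rw [hδ]; field_simp; ring
      _ < 1 - t := hR
  have hind : ∀ k ≤ N, t⁻¹ • Z k ∈ K := by
    intro k
    induction k with
    | zero => intro _; simpa [Z] using hx
    | succ k ih =>
      intro hk
      have ihk := ih (by omega)
      have hmem : Z (k + 1) ∈ K := by
        have hu : (1 - t)⁻¹ • (Z (k + 1) - Z k) ∈ K := by
          apply hball
          rw [mem_ball_zero_iff, norm_smul, norm_inv, Real.norm_of_nonneg (by linarith),
            inv_mul_lt_one₀ (by linarith)]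
          exact hstep k
        have := hK ihk hu ht0.le (by linarith : 0 ≤ 1 - t) (by ring)
        rwa [smul_inv_smul₀ ht0.ne', smul_inv_smul₀ (by linarith), add_sub_cancel] at this
      have h := hcon k (Finset.mem_range.2 (by omega))
      have hZ : Z (k + 1) = Real.cos ((k + 1) * δ) • x + Real.sin ((k + 1) * δ) • y := by
        simp only [Z]; push_cast; rfl
      rw [← hZ] at h
      by_contra hn
      exact h ⟨hmem, hn⟩
  have hlast := hAK _ (hind N le_rfl)
  have hNδ : (N : ℝ) * δ = Real.pi / 2 := by rw [hδ]; field_simp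
  simp only [Z, hNδ, Real.cos_pi_div_two, Real.sin_pi_div_two, zero_smul, zero_add,
    one_smul] at hlast
  exact hy hlast

variable [FiniteDimensional ℝ E] [MeasurableSpace E] [BorelSpace E]

lemma setIntegral_le_measureReal_dilation {K : Set E} (hK : MeasurableSet K) {t : ℝ} (ht : 0 < t) :
    ∫ x in K, (1 + Module.finrank ℝ E * Real.log t + (1 - t ^ 2) / 2 * ‖x‖ ^ 2)
        ∂(ProbabilityTheory.stdGaussian E) ≤
      (ProbabilityTheory.stdGaussian E).real {x | t⁻¹ • x ∈ K} := by
  set n := Module.finrank ℝ E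
  have hA : MeasurableSet {x : E | t⁻¹ • x ∈ K} :=
    (measurable_const_smul t⁻¹) hK
  have hR : (ProbabilityTheory.stdGaussian E).real {x | t⁻¹ • x ∈ K} =
      ∫ y : E, t ^ n * (gaussDensity (t • y) * K.indicator 1 y) := by
    rw [← integral_indicator_one hA, integral_stdGaussian, integral_const_mul]
    have h := Measure.integral_comp_smul (volume : Measure E)
      (fun x => gaussDensity x * K.indicator (1 : E → ℝ) (t⁻¹ • x)) t
    simp only [inv_smul_smul₀ ht.ne'] at h
    rw [h, abs_of_pos (by positivity), smul_eq_mul, ← mul_assoc, mul_inv_cancel₀ (by positivity),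
      one_mul]
    rfl
  have hint : Integrable (fun x : E => 1 + n * Real.log t + (1 - t ^ 2) / 2 * ‖x‖ ^ 2)
      (ProbabilityTheory.stdGaussian E) :=
    (integrable_const _).add (integrable_norm_sq_stdGaussian.const_mul _)
  rw [hR, ← integral_indicator hK, integral_stdGaussian]
  refine integral_mono (integrable_gaussDensity_mul (hint.indicator hK)) ?_ fun x => ?_
  · refine Integrable.const_mul ?_ _
    have h := (integrable_gaussDensity (E := E)).comp_smul ht.ne'
    refine (h.indicator hK).congr (Filter.Eventually.of_forall fun x => ?_)
    by_cases hx : x ∈ K <;> simp [hx]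
  · by_cases hx : x ∈ K
    · simp only [Set.indicator_of_mem hx, Pi.one_apply, mul_one]
      have h1 : t ^ n * gaussDensity (t • x) = gaussDensity x *
          Real.exp (n * Real.log t + (1 - t ^ 2) / 2 * ‖x‖ ^ 2) := by
        rw [Real.exp_add, ← Real.log_pow, Real.exp_log (by positivity)]
        unfold gaussDensity
        rw [norm_smul, Real.norm_of_nonneg ht.le]
        have : Real.exp (-(1 / 2) * (t * ‖x‖) ^ 2) =
            Real.exp (-(1 / 2) * ‖x‖ ^ 2) * Real.exp ((1 - t ^ 2) / 2 * ‖x‖ ^ 2) := by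
          rw [← Real.exp_add]; congr 1; ring
        rw [this]
        ring
      rw [h1]
      refine mul_le_mul_of_nonneg_left ?_ (gaussDensity_pos x).le
      have := Real.add_one_le_exp (n * Real.log t + (1 - t ^ 2) / 2 * ‖x‖ ^ 2)
      linarith
    · simp [hx]

lemma measureReal_mul_le_shell {K : Set E} (hKm : MeasurableSet K) (hK : Convex ℝ K)
    (hball : Metric.ball 0 1 ⊆ K)
    {t : ℝ} (ht0 : 0 < t) (ht1 : t < 1) {N : ℕ} (hN : 0 < N) {R : ℝ}
    (hR : Real.pi / N * R < 1 - t) :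
    (ProbabilityTheory.stdGaussian E).real ({x | t⁻¹ • x ∈ K} ∩ Metric.closedBall 0 R) *
      (ProbabilityTheory.stdGaussian E).real (Kᶜ ∩ Metric.closedBall 0 R) ≤
      N * (ProbabilityTheory.stdGaussian E).real (K \ {x | t⁻¹ • x ∈ K}) := by
  set γ := ProbabilityTheory.stdGaussian E
  set S := K \ {x | t⁻¹ • x ∈ K}
  have hS : MeasurableSet S := hKm.diff ((measurable_const_smul t⁻¹) hKm)
  rw [← measureReal_prod_prod]
  have hsub : ({x | t⁻¹ • x ∈ K} ∩ Metric.closedBall 0 R) ×ˢ (Kᶜ ∩ Metric.closedBall 0 R) ⊆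
      ⋃ k ∈ Finset.range N, (fun p : E × E => Real.cos ((k + 1) * (Real.pi / (2 * N))) • p.1 +
        Real.sin ((k + 1) * (Real.pi / (2 * N))) • p.2) ⁻¹' S := by
    rintro ⟨x, y⟩ ⟨⟨hx, hxR⟩, hy, hyR⟩
    obtain ⟨k, hk, h⟩ := exists_rotation_mem_shell hK hball ht0 ht1 hN hR hx
      (mem_closedBall_zero_iff.1 hxR) hy (mem_closedBall_zero_iff.1 hyR)
    exact Set.mem_biUnion hk h
  refine (measureReal_mono hsub (measure_ne_top _ _)).trans ((measureReal_biUnion_finset_le _ _).trans ?_)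
  have : ∀ k : ℕ, (γ.prod γ).real ((fun p : E × E =>
      Real.cos ((k + 1) * (Real.pi / (2 * N))) • p.1 +
        Real.sin ((k + 1) * (Real.pi / (2 * N))) • p.2) ⁻¹' S) = γ.real S := by
    intro k
    rw [← map_measureReal_apply (by fun_prop) hS, map_rotation_stdGaussian]
  simp [this]

lemma measureReal_compl_closedBall_le (hn : 0 < Module.finrank ℝ E) :
    (ProbabilityTheory.stdGaussian E).real
      (Metric.closedBall 0 (4 * √(Module.finrank ℝ E)))ᶜ ≤ 1 / 16 := by
  have hn' : (0 : ℝ) < Module.finrank ℝ E := by exact_mod_cast hn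
  have h := mul_meas_ge_le_integral_of_nonneg (μ := ProbabilityTheory.stdGaussian E)
    (f := fun x : E => ‖x‖ ^ 2) (Filter.Eventually.of_forall fun x => by positivity)
    integrable_norm_sq_stdGaussian (16 * Module.finrank ℝ E)
  rw [integral_norm_sq_stdGaussian] at h
  have hmono : (ProbabilityTheory.stdGaussian E).real
      (Metric.closedBall 0 (4 * √(Module.finrank ℝ E)))ᶜ ≤ (ProbabilityTheory.stdGaussian E).real
      {x : E | 16 * (Module.finrank ℝ E : ℝ) ≤ ‖x‖ ^ 2} := by
    refine measureReal_mono fun x hx => ?_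
    simp only [Set.mem_compl_iff, mem_closedBall_zero_iff, not_le] at hx
    have h1 := pow_le_pow_left₀ (by positivity) hx.le 2
    rw [mul_pow, Real.sq_sqrt hn'.le] at h1
    change _ ≤ ‖x‖ ^ 2
    linarith
  refine hmono.trans ?_
  rw [← mul_le_mul_iff_right₀ hn']
  change (16 * (Module.finrank ℝ E : ℝ)) * (ProbabilityTheory.stdGaussian E).real _ ≤ _ at h
  linarith

lemma le_setIntegral_finrank_sub_norm_sq {K : Set E} (hKm : MeasurableSet K) (hK : Convex ℝ K)
    (hball : Metric.ball 0 1 ⊆ K) (hn : 0 < Module.finrank ℝ E)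
    (hlow : 2 / 5 ≤ (ProbabilityTheory.stdGaussian E).real K)
    (hup : (ProbabilityTheory.stdGaussian E).real K ≤ 3 / 5) :
    1 / (640 * √(Module.finrank ℝ E)) ≤
      ∫ x in K, (Module.finrank ℝ E - ‖x‖ ^ 2) ∂(ProbabilityTheory.stdGaussian E) := by
  have hshell := fun (t : ℝ) (h0 : 0 < t) (h1 : t < 1) (N : ℕ) (hN : 0 < N) hR =>
    measureReal_mul_le_shell hKm hK hball h0 h1 hN (R := 4 * √(Module.finrank ℝ E)) hR
  have htail := measureReal_compl_closedBall_le hn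
  have hdil := fun (t : ℝ) (h0 : 0 < t) => setIntegral_le_measureReal_dilation hKm h0
  have hsecond := integral_norm_sq_stdGaussian (E := E)
  set γ := ProbabilityTheory.stdGaussian E
  set n := Module.finrank ℝ E
  have hn1 : (1 : ℝ) ≤ n := by exact_mod_cast hn
  set r := √(n : ℝ) with hr
  have hr1 : 1 ≤ r := Real.one_le_sqrt.2 hn1
  have hrr : r ^ 2 = n := Real.sq_sqrt (by linarith)
  have hrn : r ≤ n := by nlinarith
  set l : ℝ := r / (1600 * n ^ 2) with hl
  have hl0 : 0 < l := by positivity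
  have hl2 : l ≤ 1 / 1600 := by
    rw [hl, div_le_div_iff₀ (by positivity) (by norm_num)]; nlinarith
  set t : ℝ := 1 - l with ht
  have ht0 : 0 < t := by linarith
  have ht1 : t < 1 := by linarith
  set A := {x : E | t⁻¹ • x ∈ K} with hAdef
  have hA : MeasurableSet A := (measurable_const_smul t⁻¹) hKm
  have hAK : A ⊆ K := fun z hz => by
    have := hK.smul_mem_of_zero_mem (hball (by simp)) hz (t := t) ⟨ht0.le, ht1.le⟩
    rwa [smul_inv_smul₀ ht0.ne'] at this
  set s := γ.real (K \ A) with hs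
  have hsA : γ.real A = γ.real K - s := by
    rw [hs, measureReal_sdiff hAK hA]; ring
  have hs0 : 0 ≤ s := measureReal_nonneg
  have hmain := hshell t ht0 ht1 (25600 * n ^ 2) (by positivity) (by
    rw [ht, sub_sub_cancel, hl]
    push_cast
    have : Real.pi < 4 := Real.pi_lt_four
    rw [div_mul_eq_mul_div, div_lt_div_iff₀ (by positivity) (by positivity)]
    have : 0 < r * (n : ℝ) ^ 2 := by positivity
    nlinarith)
  have hcap : ∀ B : Set E, γ.real B - 1 / 16 ≤ γ.real (B ∩ Metric.closedBall 0 (4 * r)) := by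
    intro B
    have h1 : γ.real B ≤ γ.real (B ∩ Metric.closedBall 0 (4 * r)) +
        γ.real (Metric.closedBall 0 (4 * r))ᶜ := by
      refine (measureReal_mono (fun x hx => ?_)).trans (measureReal_union_le _ _)
      by_cases hxb : x ∈ Metric.closedBall (0 : E) (4 * r)
      · exact Or.inl ⟨hx, hxb⟩
      · exact Or.inr hxb
    linarith
  have hcA := hcap A
  have hcK := hcap Kᶜ
  rw [measureReal_compl hKm, probReal_univ] at hcK
  have hsl : l / (320 * r) ≤ s := by
    have e : l / (320 * r) = 1 / (512000 * n ^ 2) := by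
      rw [hl]; field_simp; norm_num
    rw [e, div_le_iff₀ (by positivity)]
    push_cast at hmain
    have hn2 : (1 : ℝ) ≤ (n : ℝ) ^ 2 := one_le_pow₀ hn1
    by_cases hs1 : s ≤ 1 / 16
    · have : (1 / 5 : ℝ) * (1 / 5) ≤ 25600 * n ^ 2 * s := by
        refine le_trans ?_ hmain
        exact mul_le_mul (by linarith) (by linarith) (by norm_num) measureReal_nonneg
      nlinarith
    · push Not at hs1
      nlinarith
  have hd := hdil t ht0
  have hintsq := (integrable_norm_sq_stdGaussian (E := E)).restrict (s := K)
  have hconst : ∀ c : ℝ, ∫ _ in K, c ∂γ = γ.real K * c := fun c => by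
    rw [setIntegral_const, smul_eq_mul]
  rw [integral_add (integrable_const _) (hintsq.const_mul _), hconst, integral_const_mul] at hd
  rw [integral_sub (integrable_const _) hintsq, hconst]
  have hI1 : ∫ x in K, ‖x‖ ^ 2 ∂γ ≤ n := by
    rw [← hsecond]
    exact setIntegral_le_integral integrable_norm_sq_stdGaussian
      (Filter.Eventually.of_forall fun x => by positivity)
  set I := ∫ x in K, ‖x‖ ^ 2 ∂γ
  change _ ≤ γ.real A at hd
  rw [hsA] at hd
  have hlog : -(l + 2 * l ^ 2) ≤ Real.log t := by
    have h1 := Real.one_sub_inv_le_log_of_pos ht0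
    have h2 : t⁻¹ ≤ 1 + l + 2 * l ^ 2 := by
      rw [inv_le_iff_one_le_mul₀ ht0, ht]
      nlinarith [sq_nonneg l, mul_pos hl0 hl0, mul_pos (mul_pos hl0 hl0) hl0]
    linarith
  set p := γ.real K
  have hup' : s ≤ l * (p * n - I) + 5 / 2 * n * l ^ 2 := by
    have h1 : -(n * Real.log t) ≤ n * (l + 2 * l ^ 2) := by nlinarith
    have h2 : p * -(n * Real.log t) ≤ p * (n * (l + 2 * l ^ 2)) :=
      mul_le_mul_of_nonneg_left h1 (by linarith)
    have h3 : p * (n * l ^ 2) ≤ 1 * (n * l ^ 2) :=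
      mul_le_mul_of_nonneg_right (by linarith) (by positivity)
    have h4 : l ^ 2 * I ≤ l ^ 2 * n := mul_le_mul_of_nonneg_left hI1 (by positivity)
    have h5 : (1 - t ^ 2) / 2 = l - l ^ 2 / 2 := by rw [ht]; ring
    rw [h5] at hd
    nlinarith
  have hfin : l * (1 / (320 * r)) ≤ l * (p * n - I + 5 / 2 * n * l) := by
    calc l * (1 / (320 * r)) = l / (320 * r) := by ring
      _ ≤ s := hsl
      _ ≤ _ := hup'
      _ = _ := by ring
  have h6 := le_of_mul_le_mul_left hfin hl0
  have h7 : 5 / 2 * n * l = 1 / (640 * r) := by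
    rw [hl, ← hrr]; field_simp; norm_num
  have h8 : 1 / (320 * r) = 1 / (640 * r) + 1 / (640 * r) := by field_simp; norm_num
  linarith

end ConvexShell

section HermiteWeight

lemma rootStdGaussian_eq (n : ℕ) :
    _root_.stdGaussian n = ProbabilityTheory.stdGaussian (EuclideanSpace ℝ (Fin n)) :=
  map_pi_eq_stdGaussian

lemma hermiteWeight_nonneg (n : ℕ) (f : EuclideanSpace ℝ (Fin n) → ℝ) (j : ℕ) :
    0 ≤ hermiteWeight n f j :=
  tsum_nonneg fun _ => sq_nonneg _

lemma finite_sum_eq (n j : ℕ) : Finite {S : Fin n → ℕ // ∑ i, S i = j} := by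
  refine ((Set.finite_Iic (fun _ : Fin n => j)).subset fun S hS i => ?_).to_subtype
  have hS' : ∑ i, S i = j := hS
  exact hS' ▸ Finset.single_le_sum (fun _ _ => Nat.zero_le _) (Finset.mem_univ i)

lemma sum_sq_hermiteCoeff_single_le (n j : ℕ) (hj : j ≠ 0)
    (f : EuclideanSpace ℝ (Fin n) → ℝ) :
    ∑ i, hermiteCoeff n f (Pi.single i j) ^ 2 ≤ hermiteWeight n f j := by
  have := finite_sum_eq n j
  let e : Fin n ↪ {S : Fin n → ℕ // ∑ i, S i = j} :=
    ⟨fun i => ⟨Pi.single i j, by simp⟩, fun i k h => by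
      by_contra hik
      have := congrFun (congrArg Subtype.val h) i
      simp [Pi.single_eq_of_ne hik, hj] at this⟩
  have h := Summable.sum_le_tsum (f := fun S : {S : Fin n → ℕ // ∑ i, S i = j} =>
    hermiteCoeff n f S.1 ^ 2) (Finset.univ.map e) (fun _ _ => sq_nonneg _)
    (Summable.of_finite (L := .unconditional _))
  rw [Finset.sum_map] at h
  exact h

lemma normHermite_zero (x : ℝ) : normHermite 0 x = 1 := by
  simp [normHermite]

lemma normHermite_two (x : ℝ) : normHermite 2 x = (√2)⁻¹ * (x ^ 2 - 1) := by
  rw [normHermite, Polynomial.hermite_succ, Polynomial.hermite_one]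
  simp
  ring

lemma hermiteCoeff_single_two (n : ℕ) (f : EuclideanSpace ℝ (Fin n) → ℝ) (i : Fin n) :
    hermiteCoeff n f (Pi.single i 2) =
      (√2)⁻¹ * ∫ x, f x * (x i ^ 2 - 1)
        ∂(ProbabilityTheory.stdGaussian (EuclideanSpace ℝ (Fin n))) := by
  rw [hermiteCoeff, rootStdGaussian_eq, ← integral_const_mul]
  congr 1
  ext x
  rw [Fintype.prod_eq_single i fun k hk => by rw [Pi.single_eq_of_ne hk, normHermite_zero],
    Pi.single_eq_same, normHermite_two]
  ring

lemma pmInd_eq_indicator {n : ℕ} (K : Set (EuclideanSpace ℝ (Fin n))) :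
    pmInd K = fun x => 2 * K.indicator 1 x - 1 := by
  ext x
  by_cases hx : x ∈ K <;> simp [pmInd, hx]
  norm_num

lemma sum_hermiteCoeff_single_two {n : ℕ} {K L : Set (EuclideanSpace ℝ (Fin n))}
    (hL : MeasurableSet L)
    (hKL : K =ᵐ[ProbabilityTheory.stdGaussian (EuclideanSpace ℝ (Fin n))] L) :
    ∑ i, hermiteCoeff n (pmInd K) (Pi.single i 2) =
      -(√2 * ∫ x in L, (n - ‖x‖ ^ 2)
        ∂(ProbabilityTheory.stdGaussian (EuclideanSpace ℝ (Fin n)))) := by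
  have hsecond := integral_norm_sq_stdGaussian (E := EuclideanSpace ℝ (Fin n))
  have hintsq := integrable_norm_sq_stdGaussian (E := EuclideanSpace ℝ (Fin n))
  simp_rw [hermiteCoeff_single_two]
  set γ := ProbabilityTheory.stdGaussian (EuclideanSpace ℝ (Fin n))
  have hcoord : ∀ i, Integrable (fun x : EuclideanSpace ℝ (Fin n) => x i ^ 2 - 1) γ := by
    intro i
    refine Integrable.sub ?_ (integrable_const _)
    refine hintsq.mono' (by fun_prop) (Filter.Eventually.of_forall fun x => ?_)
    rw [Real.norm_eq_abs, abs_of_nonneg (sq_nonneg _), EuclideanSpace.real_norm_sq_eq]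
    exact Finset.single_le_sum (f := fun i => x i ^ 2) (fun _ _ => sq_nonneg _) (Finset.mem_univ i)
  have hint : Integrable (fun x : EuclideanSpace ℝ (Fin n) => (n : ℝ) - ‖x‖ ^ 2) γ :=
    (integrable_const _).sub hintsq
  have hswap : ∀ i, ∫ x, pmInd K x * (x i ^ 2 - 1) ∂γ = ∫ x, pmInd L x * (x i ^ 2 - 1) ∂γ := by
    intro i
    refine integral_congr_ae ?_
    filter_upwards [indicator_ae_eq_of_ae_eq_set (f := (1 : EuclideanSpace ℝ (Fin n) → ℝ)) hKL] with x hx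
    simp only [pmInd_eq_indicator, hx]
  have hmul : ∀ i, Integrable (fun x => pmInd L x * (x i ^ 2 - 1)) γ := by
    intro i
    have : (fun x : EuclideanSpace ℝ (Fin n) => pmInd L x * (x i ^ 2 - 1)) = fun x =>
        2 * L.indicator (fun x => x i ^ 2 - 1) x - (x i ^ 2 - 1) := by
      ext x
      by_cases hx : x ∈ L <;> simp [pmInd_eq_indicator, hx]
      ring
    rw [this]
    exact (((hcoord i).indicator hL).const_mul 2).sub (hcoord i)
  simp_rw [hswap]
  rw [← Finset.mul_sum, ← integral_finsetSum _ fun i _ => hmul i]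
  have : (fun x : EuclideanSpace ℝ (Fin n) => ∑ i, pmInd L x * (x i ^ 2 - 1)) = fun x =>
      (n - ‖x‖ ^ 2) - 2 * L.indicator (fun x => (n : ℝ) - ‖x‖ ^ 2) x := by
    ext x
    rw [← Finset.mul_sum, Finset.sum_sub_distrib, ← EuclideanSpace.real_norm_sq_eq]
    by_cases hx : x ∈ L <;> simp [pmInd_eq_indicator, hx]
    ring
  rw [this, integral_sub hint ((hint.indicator hL).const_mul 2), integral_const_mul,
    integral_indicator hL, integral_sub (integrable_const _) hintsq, hsecond]
  simp only [integral_const, probReal_univ, one_smul, finrank_euclideanSpace, Fintype.card_fin,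
    sub_self, zero_sub]
  have h2 : √2 ^ 2 = (2 : ℝ) := Real.sq_sqrt (by norm_num)
  have h0 : √2 ≠ (0 : ℝ) := by positivity
  field_simp
  rw [h2]

end HermiteWeight

/-- If `K` is convex, its Gaussian volume is within `c/n` of `1/2`, and `K` contains
the ball `B(0ⁿ, τ)`, then the Hermite weight of `K` at levels 0, 1 and 2 is at least
`c'/n²`. -/
theorem low_level_weight_ball :
    ∃ τ c c' : ℝ, 0 < τ ∧ τ ≤ c ∧ 0 < c' ∧ ∃ n₀ : ℕ, ∀ n : ℕ, n₀ ≤ n →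
      ∀ K : Set (EuclideanSpace ℝ (Fin n)),
        Convex ℝ K →
        |gaussVol n K - 1 / 2| ≤ c / (n : ℝ) →
        Metric.closedBall (0 : EuclideanSpace ℝ (Fin n)) τ ⊆ K →
        c' / (n : ℝ) ^ 2 ≤
          hermiteWeight n (pmInd K) 0 + hermiteWeight n (pmInd K) 1
            + hermiteWeight n (pmInd K) 2 := by
  refine ⟨1, 1, 2 / 640 ^ 2, one_pos, le_rfl, by positivity, 10, fun n hn K hK hvol hball => ?_⟩
  have hn10 : (10 : ℝ) ≤ n := by exact_mod_cast hn
  have hL : MeasurableSet (interior K) := isOpen_interior.measurableSet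
  have hKL : interior K =ᵐ[ProbabilityTheory.stdGaussian (EuclideanSpace ℝ (Fin n))] K := by
    have hac : ProbabilityTheory.stdGaussian (EuclideanSpace ℝ (Fin n)) ≪ volume := by
      rw [stdGaussian_eq_withDensity]
      exact withDensity_absolutelyContinuous _ _
    exact hac.ae_eq (interior_ae_eq_of_null_frontier (hK.addHaar_frontier volume))
  have hLball : Metric.ball 0 1 ⊆ interior K :=
    interior_maximal (Metric.ball_subset_closedBall.trans hball) Metric.isOpen_ball
  rw [gaussVol, rootStdGaussian_eq, ← measureReal_def, ← measureReal_congr hKL, abs_le] at hvol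
  have hinv : 1 / (n : ℝ) ≤ 1 / 10 := one_div_le_one_div_of_le (by norm_num) hn10
  have hD := le_setIntegral_finrank_sub_norm_sq hL hK.interior hLball
    (by rw [finrank_euclideanSpace, Fintype.card_fin]; omega) (by linarith) (by linarith)
  have hsum := sum_hermiteCoeff_single_two hL hKL.symm
  have hCS := sq_sum_le_card_mul_sum_sq (s := Finset.univ)
    (f := fun i : Fin n => hermiteCoeff n (pmInd K) (Pi.single i 2))
  rw [hsum, Finset.card_univ, Fintype.card_fin, neg_sq, mul_pow,
    Real.sq_sqrt (by norm_num)] at hCS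
  rw [finrank_euclideanSpace, Fintype.card_fin] at hD
  have hW := sum_sq_hermiteCoeff_single_le n 2 two_ne_zero (pmInd K)
  have hW0 := hermiteWeight_nonneg n (pmInd K) 0
  have hW1 := hermiteWeight_nonneg n (pmInd K) 1
  have hsq := pow_le_pow_left₀ (by positivity) hD 2
  rw [div_pow, mul_pow, Real.sq_sqrt (by linarith)] at hsq
  have hnW : (n : ℝ) * (2 / 640 ^ 2 / (n : ℝ) ^ 2) ≤ n * hermiteWeight n (pmInd K) 2 := by
    calc (n : ℝ) * (2 / 640 ^ 2 / (n : ℝ) ^ 2) = 2 * (1 ^ 2 / (640 ^ 2 * n)) := by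
          field_simp
      _ ≤ _ := (mul_le_mul_of_nonneg_left hsq zero_le_two).trans
          (hCS.trans (mul_le_mul_of_nonneg_left hW (by linarith)))
  linarith [le_of_mul_le_mul_left hnW (by linarith : (0 : ℝ) < n)]
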